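/- Let A be a unital alternative *-algebra over ℂ containing a nontrivial symmetric idempotent e satisfying conditions (♠) and (♣), and let Φ : A → A be a map satisfying the *-Jordan n-derivation identity in the last two slots. Then Φ(a*) = Φ(a)* for all a ∈ A. -/

import Mathlib

/-- The Jordan `•`-product `a • b = ab + b a*`. -/
def starJordan {A : Type*} [NonAssocRing A] [StarRing A] (a b : A) : A :=
  a * b + b * star a

/-- Left-normed iterated Jordan `•`-product of a list (empty list ↦ 0, junk value). -/
def leftStarJordan {A : Type*} [NonAssocRing A] [StarRing A] : List A → A
  | [] => 0
  | x :: xs => xs.foldl starJordan x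

/-- The family `a₁ = ⋯ = a_{n-2} = 1`, `a_{n-1} = x`, `a_n = y`. -/
def lastTwoFamily {A : Type*} [One A] (n : ℕ) (x y : A) : Fin n → A :=
  fun i => if (i : ℕ) = n - 2 then x else if (i : ℕ) = n - 1 then y else 1

/-- `e₁ = e`, `e₂ = 1 - e`. -/
def peirceIdem {A : Type*} [NonAssocRing A] (e : A) : Fin 2 → A :=
  fun i => if i = 0 then e else 1 - e

/-- Membership in the Peirce component `A_{ij}`: `eᵢ x = x` and `x eⱼ = x`. -/
def inPeirce {A : Type*} [NonAssocRing A] (e : A) (i j : Fin 2) (x : A) : Prop :=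
  peirceIdem e i * x = x ∧ x * peirceIdem e j = x

/-- The inner derivation `Ξ_{y,z}(a) = y(za) − z(ya) + y(az) − (ya)z + (az)y − (ay)z`. -/
def innerDer {A : Type*} [NonAssocRing A] (y z a : A) : A :=
  y * (z * a) - z * (y * a) + y * (a * z) - (y * a) * z + (a * z) * y - (a * y) * z

local notation:70 x:70 " ⋄ " y:71 => starJordan x y

section JordanProduct

variable {A : Type*} [NonAssocRing A] [StarRing A]

theorem starJordan_def (x y : A) : x ⋄ y = x * y + y * star x := rfl

theorem add_starJordan (x y z : A) : (x + y) ⋄ z = x ⋄ z + y ⋄ z := by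
  simp only [starJordan_def, star_add, add_mul, mul_add]; abel

theorem starJordan_add (x y z : A) : x ⋄ (y + z) = x ⋄ y + x ⋄ z := by
  simp only [starJordan_def, add_mul, mul_add]; abel

theorem sub_starJordan (x y z : A) : (x - y) ⋄ z = x ⋄ z - y ⋄ z := by
  simp only [starJordan_def, star_sub, sub_mul, mul_sub]; abel

theorem starJordan_sub (x y z : A) : x ⋄ (y - z) = x ⋄ y - x ⋄ z := by
  simp only [starJordan_def, sub_mul, mul_sub]; abel

@[simp] theorem zero_starJordan (x : A) : (0 : A) ⋄ x = 0 := by simp [starJordan_def]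

@[simp] theorem starJordan_zero (x : A) : x ⋄ (0 : A) = 0 := by simp [starJordan_def]

theorem one_starJordan (x : A) : (1 : A) ⋄ x = x + x := by simp [starJordan_def]

theorem nsmul_starJordan (m : ℕ) (x y : A) : (m • x) ⋄ y = m • (x ⋄ y) := by
  simp only [starJordan_def, star_nsmul, smul_mul_assoc, mul_smul_comm, smul_add]

theorem starJordan_nsmul (m : ℕ) (x y : A) : x ⋄ (m • y) = m • (x ⋄ y) := by
  simp only [starJordan_def, smul_mul_assoc, mul_smul_comm, smul_add]

theorem sum_starJordan {ι : Type*} (s : Finset ι) (f : ι → A) (y : A) :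
    (∑ i ∈ s, f i) ⋄ y = ∑ i ∈ s, f i ⋄ y := by
  simp [starJordan_def, star_sum, Finset.sum_mul, Finset.mul_sum, Finset.sum_add_distrib]

theorem leftStarJordan_ofFn_succ {m : ℕ} (f : Fin (m + 2) → A) :
    leftStarJordan (List.ofFn f) =
      leftStarJordan (List.ofFn fun i : Fin (m + 1) => f i.castSucc) ⋄ f (Fin.last _) := by
  rw [List.ofFn_succ', List.ofFn_succ]
  simp [leftStarJordan, List.concat_eq_append, List.foldl_append]

theorem leftStarJordan_ones (m : ℕ) :
    leftStarJordan (List.ofFn fun _ : Fin (m + 1) => (1 : A)) = 2 ^ m • (1 : A) := by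
  induction m with
  | zero => simp [leftStarJordan]
  | succ m ih =>
    rw [leftStarJordan_ofFn_succ, ih, nsmul_starJordan, one_starJordan, pow_succ, mul_nsmul,
      two_nsmul, nsmul_add]

/-- Replacing one entry of a product of ones by `d` gives a combination of `d` and `star d`. -/
theorem exists_leftStarJordan_update_one (d : A) (m : ℕ) (f : Fin (m + 1) → A)
    (k : Fin (m + 1)) (hk : f k = d) (hf : ∀ i, i ≠ k → f i = 1) :
    ∃ p q : ℕ, leftStarJordan (List.ofFn f) = p • d + q • star d := by
  induction m with
  | zero =>
    refine ⟨1, 0, ?_⟩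
    obtain rfl : k = 0 := Fin.fin_one_eq_zero k
    simp [leftStarJordan, hk]
  | succ m ih =>
    rw [leftStarJordan_ofFn_succ]
    induction k using Fin.lastCases with
    | last =>
      have h1 : (fun i : Fin (m + 1) => f i.castSucc) = fun _ => 1 :=
        funext fun i => hf _ (Fin.castSucc_lt_last i).ne
      refine ⟨2 ^ m * 2, 0, ?_⟩
      rw [h1, leftStarJordan_ones, hk, nsmul_starJordan, one_starJordan, mul_nsmul, two_nsmul]
      simp
    | cast k =>
      obtain ⟨p, q, h⟩ := ih (fun i => f i.castSucc) k hk fun i hi =>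
        hf _ fun h => hi (Fin.castSucc_injective _ h)
      refine ⟨p + q, p + q, ?_⟩
      rw [h, hf _ (Fin.castSucc_lt_last k).ne']
      simp only [starJordan_def, star_add, star_nsmul, star_star, mul_one, one_mul, add_nsmul]
      abel

/-- The derivation identity in the last two slots, with the leading ones evaluated. -/
theorem exists_lastTwo_identity {n : ℕ} (hn : 2 ≤ n) {Φ : A → A}
    (hΦ : ∀ x y : A,
      Φ (leftStarJordan (List.ofFn (lastTwoFamily n x y))) =
        ∑ k : Fin n, leftStarJordan (List.ofFn
          (Function.update (lastTwoFamily n x y) k (Φ (lastTwoFamily n x y k))))) :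
    ∃ M p q : ℕ, M ≠ 0 ∧ ∀ x y : A, Φ (M • (x ⋄ y)) =
      M • (Φ x ⋄ y + x ⋄ Φ y) + ((p • Φ 1 + q • star (Φ 1)) ⋄ x) ⋄ y := by
  obtain ⟨N, rfl⟩ : ∃ N, n = N + 2 := ⟨n - 2, by omega⟩
  cases N with
  | zero =>
    refine ⟨1, 0, 0, one_ne_zero, fun x y => ?_⟩
    have h := hΦ x y
    simpa [leftStarJordan, lastTwoFamily, Fin.sum_univ_two, Function.update] using h
  | succ m =>
    have hcore : ∀ k : Fin (m + 1), ∃ p q : ℕ, leftStarJordan (List.ofFn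
        (Function.update (fun _ : Fin (m + 1) => (1 : A)) k (Φ 1))) =
          p • Φ 1 + q • star (Φ 1) := fun k =>
      exists_leftStarJordan_update_one _ m _ k (by simp) fun i hi => by simp [hi]
    choose p q hpq using hcore
    refine ⟨2 ^ (m + 1), ∑ k, p k, ∑ k, q k, by positivity, fun x y => ?_⟩
    have hsplit : ∀ f : Fin (m + 1 + 2) → A, leftStarJordan (List.ofFn f) =
        (leftStarJordan (List.ofFn fun i : Fin (m + 1) => f i.castSucc.castSucc) ⋄
          f (Fin.last _).castSucc) ⋄ f (Fin.last _) := fun f => by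
      rw [leftStarJordan_ofFn_succ, leftStarJordan_ofFn_succ]
    have f1 : ∀ i : Fin (m + 1), lastTwoFamily (m + 1 + 2) x y i.castSucc.castSucc = 1 := by
      intro i
      have := i.2
      simp only [lastTwoFamily, Fin.val_castSucc]
      rw [if_neg (by omega), if_neg (by omega)]
    have f2 : lastTwoFamily (m + 1 + 2) x y (Fin.last _).castSucc = x := by
      simp [lastTwoFamily]
    have f3 : lastTwoFamily (m + 1 + 2) x y (Fin.last _) = y := by
      simp [lastTwoFamily]
    have hpow : ∀ z w : A, ((2 ^ m • (1 : A)) ⋄ z) ⋄ w = 2 ^ (m + 1) • (z ⋄ w) := by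
      intro z w
      rw [nsmul_starJordan, one_starJordan, nsmul_starJordan, add_starJordan, ← two_nsmul,
        ← mul_nsmul', pow_succ]
    have h := hΦ x y
    rw [hsplit, Fin.sum_univ_castSucc, Fin.sum_univ_castSucc] at h
    simp only [hsplit, f1, f2, f3, leftStarJordan_ones, hpow] at h
    have g1 : ∀ k : Fin (m + 1), (fun i : Fin (m + 1) =>
        Function.update (lastTwoFamily (m + 1 + 2) x y) k.castSucc.castSucc (Φ 1)
          i.castSucc.castSucc) = Function.update (fun _ => (1 : A)) k (Φ 1) := by
      intro k
      funext i
      by_cases hik : i = k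
      · subst hik; simp
      · rw [Function.update_of_ne hik, Function.update_of_ne, f1]
        exact fun h => hik (Fin.castSucc_injective _ (Fin.castSucc_injective _ h))
    have g2 : ∀ (j : Fin (m + 1 + 2)) (z : A), (∀ i : Fin (m + 1), i.castSucc.castSucc ≠ j) →
        (fun i : Fin (m + 1) => Function.update (lastTwoFamily (m + 1 + 2) x y) j z
          i.castSucc.castSucc) = fun _ => 1 := by
      intro j z hj
      funext i
      rw [Function.update_of_ne (hj i), f1]
    have n1 : ∀ i : Fin (m + 1), i.castSucc.castSucc ≠ (Fin.last (m + 1)).castSucc :=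
      fun i h => (Fin.castSucc_lt_last i).ne (Fin.castSucc_injective _ h)
    have n2 : ∀ i : Fin (m + 2), i.castSucc ≠ Fin.last (m + 2) :=
      fun i => (Fin.castSucc_lt_last i).ne
    have key : ∀ k : Fin (m + 1), leftStarJordan (List.ofFn fun i : Fin (m + 1) =>
        Function.update (lastTwoFamily (m + 1 + 2) x y) k.castSucc.castSucc (Φ 1)
          i.castSucc.castSucc) = p k • Φ 1 + q k • star (Φ 1) := fun k => by rw [g1, hpq]
    simp only [key, g2 _ _ n1, f1, leftStarJordan_ones, hpow,
      Function.update_self, Function.update_of_ne (n1 _).symm, Function.update_of_ne (n2 _).symm,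
      Function.update_of_ne (n2 _), f2, f3] at h
    rw [h, ← sum_starJordan, ← sum_starJordan, Finset.sum_add_distrib, ← Finset.sum_smul,
      ← Finset.sum_smul, nsmul_add]
    abel

end JordanProduct

section SelfAdjoint

variable {A : Type*} [NonAssocRing A] [StarRing A] {e : A}

theorem self_mul_star (he : star e = e) (a : A) : e * star a = star (a * e) := by
  rw [star_mul, he]

theorem star_mul_self_eq (he : star e = e) (a : A) : star a * e = star (e * a) := by
  rw [star_mul, he]

end SelfAdjoint

section Peirce

variable {A : Type*} [NonAssocRing A]

/-- Left alternativity, linearised. -/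
theorem mul_mul_of_left_alternative (halt : ∀ a b : A, a * a * b = a * (a * b)) (e x y : A) :
    e * (x * y) = e * x * y + x * e * y - x * (e * y) := by
  have h := halt (e + x) y
  simp only [mul_add, add_mul, halt] at h
  have h2 : e * (x * y) + x * (e * y) = e * x * y + x * e * y := by
    have := sub_eq_zero.2 h
    rw [eq_comm, ← sub_eq_zero, ← this]; abel
  rw [← h2]; abel

/-- Right alternativity, linearised. -/
theorem mul_mul_of_right_alternative (halt : ∀ a b : A, b * a * a = b * (a * a)) (e x y : A) :
    x * y * e = x * (y * e) + x * (e * y) - x * e * y := by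
  have h := halt (e + y) x
  simp only [mul_add, add_mul, halt] at h
  have h2 : x * y * e + x * e * y = x * (y * e) + x * (e * y) := by
    have := sub_eq_zero.2 h
    rw [← sub_eq_zero, ← this]; abel
  rw [← h2]; abel

/-- Alternative rings are flexible. -/
theorem flexible_of_alternative (halt₁ : ∀ a b : A, a * a * b = a * (a * b))
    (halt₂ : ∀ a b : A, b * a * a = b * (a * a)) (e x : A) : e * (x * e) = e * x * e := by
  have := mul_mul_of_left_alternative halt₁ e x e
  rw [this, halt₂]; abel

theorem eq_zero_of_mul_idem_eq_add_self (htf : ∀ x : A, x + x = 0 → x = 0)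
    (halt₂ : ∀ a b : A, b * a * a = b * (a * a)) {e z : A} (he : e * e = e)
    (h : z * e = z + z) : z = 0 := by
  have h1 := halt₂ e z
  rw [he, h, add_mul, h] at h1
  exact htf _ (by simpa using h1)

/-- `A₁₂ A₁₁ = 0`. -/
theorem mul_eq_zero_of_peirce (htf : ∀ x : A, x + x = 0 → x = 0)
    (halt₂ : ∀ a b : A, b * a * a = b * (a * a)) {e x y : A} (he : e * e = e)
    (hx : x * e = 0) (hy : e * y = y) (hy' : y * e = y) : x * y = 0 := by
  refine eq_zero_of_mul_idem_eq_add_self htf halt₂ he ?_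
  rw [mul_mul_of_right_alternative halt₂, hx, hy, hy']; simp

/-- An element of `A₁₁` annihilating `A₁₂` on the left vanishes. -/
theorem eq_zero_of_mul_peirce_eq_zero (htf : ∀ x : A, x + x = 0 → x = 0)
    (halt₁ : ∀ a b : A, a * a * b = a * (a * b))
    (halt₂ : ∀ a b : A, b * a * a = b * (a * a)) {e z : A} (he : e * e = e)
    (hcl : ∀ x : A, (∀ r : A, x * r * (1 - e) = 0) → x = 0)
    (hz : e * z = z) (hz' : z * e = z)
    (h : ∀ a : A, e * a = a → a * e = 0 → z * a = 0) : z = 0 := by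
  refine hcl z fun r => ?_
  have hee : ∀ w : A, e * (e * w) = e * w := fun w => by rw [← halt₁, he]
  have hee' : ∀ w : A, w * e * e = w * e := fun w => by rw [halt₂, he]
  have h1 := h (e * r - e * r * e) (by
    rw [mul_sub, hee, ← flexible_of_alternative halt₁ halt₂, hee]) (by
    rw [sub_mul, hee', sub_self])
  rw [mul_sub, sub_eq_zero] at h1
  have h2 : ∀ w, z * (e * w) = z * w := fun w => by
    have := mul_mul_of_left_alternative halt₁ e z w
    rw [hz, hz'] at this
    have h3 : e * (z * w) = z * w := by
      have h4 := congrArg (e * ·) this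
      simp only [mul_sub, mul_add, hee] at h4
      have h5 := mul_mul_of_left_alternative halt₁ e z (e * w)
      rw [hz, hz', hee] at h5
      rw [h5] at h4
      rw [this] at h4 ⊢
      have h6 := sub_eq_zero.2 h4
      have h7 : z * w - z * (e * w) = 0 := htf _ (by rw [← neg_eq_zero, ← h6]; abel)
      rw [sub_eq_zero] at h7
      rw [← h7]; abel
    rw [h3] at this
    have h6 := sub_eq_zero.2 this
    rw [← sub_eq_zero, ← h6]; abel
  rw [h2] at h1
  have h3 := mul_mul_of_right_alternative halt₂ e z r
  rw [hz', h2] at h3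
  have h4 : z * r * e = z * (r * e) := by rw [h3]; abel
  rw [mul_sub, mul_one, h4, h1, ← flexible_of_alternative halt₁ halt₂, h2, sub_self]

end Peirce

/-- The deviation of a map from additivity. -/
def addDefect {A : Type*} [AddGroup A] (F : A → A) (u v : A) : A := F (u + v) - F u - F v

theorem map_add_of_addDefect {A : Type*} [AddCommGroup A] {F : A → A} {u v : A}
    (h : addDefect F u v = 0) : F (u + v) = F u + F v := by
  rw [addDefect, sub_sub, sub_eq_zero] at h
  exact h

/-- `F (x ⋄ y) = G x ⋄ y + x ⋄ H y`, where `G` and `H` deviate equally from additivity. -/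
structure IsStarJordanTriple {A : Type*} [NonAssocRing A] [StarRing A] (F G H : A → A) :
    Prop where
  map : ∀ x y, F (x ⋄ y) = G x ⋄ y + x ⋄ H y
  defect : ∀ u v, addDefect G u v = addDefect H u v

namespace IsStarJordanTriple

variable {A : Type*} [NonAssocRing A] [StarRing A] {F G H : A → A}

theorem left_zero (h : IsStarJordanTriple F G H) : F 0 = 0 := by
  simpa using h.map 0 0

theorem right_zero (h : IsStarJordanTriple F G H) (htf : ∀ x : A, x + x = 0 → x = 0) :
    H 0 = 0 := by
  have := h.map 1 0
  rw [starJordan_zero, h.left_zero, starJordan_zero, one_starJordan, zero_add] at this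
  exact htf _ this.symm

theorem defect_zero_left (h : IsStarJordanTriple F G H) (v : A) : addDefect F 0 v = 0 := by
  simp [addDefect, h.left_zero]

theorem defect_zero_right (h : IsStarJordanTriple F G H) (v : A) : addDefect F v 0 = 0 := by
  simp [addDefect, h.left_zero]

theorem starJordan_defect (h : IsStarJordanTriple F G H) (x u v : A) :
    x ⋄ addDefect H u v = addDefect F (x ⋄ u) (x ⋄ v) := by
  simp only [addDefect, ← starJordan_add, h.map, starJordan_sub]
  rw [starJordan_add (G x)]; abel

theorem defect_starJordan (h : IsStarJordanTriple F G H) (u v y : A) :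
    addDefect H u v ⋄ y = addDefect F (u ⋄ y) (v ⋄ y) := by
  rw [← h.defect]
  simp only [addDefect, ← add_starJordan, h.map, sub_starJordan]
  rw [add_starJordan u v (H y)]; abel

/-- The additivity defects of `F` and `H` are proportional. -/
theorem defect_add_self (h : IsStarJordanTriple F G H) (u v : A) :
    addDefect F (u + u) (v + v) = addDefect H u v + addDefect H u v := by
  rw [← one_starJordan, ← one_starJordan, ← h.starJordan_defect, one_starJordan]

theorem left_defect [Module ℂ A] (h : IsStarJordanTriple F G H) (u v : A) :
    addDefect F u v = addDefect H ((2⁻¹ : ℂ) • u) ((2⁻¹ : ℂ) • v) +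
      addDefect H ((2⁻¹ : ℂ) • u) ((2⁻¹ : ℂ) • v) := by
  have hh : ∀ x : A, (2⁻¹ : ℂ) • x + (2⁻¹ : ℂ) • x = x := fun x => by
    rw [← add_smul]; norm_num
  rw [← h.defect_add_self, hh, hh]

theorem right_defect_eq_zero (h : IsStarJordanTriple F G H)
    (htf : ∀ x : A, x + x = 0 → x = 0) {u v : A} (huv : addDefect F (u + u) (v + v) = 0) :
    addDefect H u v = 0 :=
  htf _ (by rw [← h.defect_add_self, huv])

variable {e : A}

section Idempotent

variable (h : IsStarJordanTriple F G H) (htf : ∀ x : A, x + x = 0 → x = 0) (heStar : star e = e)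

include h htf heStar

theorem offDiagonal_of_map_zero {u v : A} (hv : e * v + v * e = v) :
    e * addDefect H u v + addDefect H u v * e = addDefect H u v := by
  have h1 := h.starJordan_defect (e - (1 - e)) u v
  have h2 : (e - (1 - e)) ⋄ v = 0 := by
    have h0 := sub_eq_zero.2 hv
    have h3 : (e - (1 - e)) ⋄ v = (e * v + v * e - v) + (e * v + v * e - v) := by
      simp only [starJordan_def, star_sub, star_one, heStar, sub_mul, mul_sub, one_mul, mul_one]
      abel
    rw [h3, h0, add_zero]
  rw [h2, h.defect_zero_right] at h1
  refine sub_eq_zero.1 (htf _ ?_)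
  rw [← h1]
  simp only [starJordan_def, star_sub, star_one, heStar, sub_mul, mul_sub, one_mul, mul_one]
  abel

theorem defect_diagonal_diagonal {u v : A} (hu : e * u = u) (hu' : u * e = u)
    (hv : e * v = 0) (hv' : v * e = 0) : addDefect H u v = 0 := by
  have h1 := h.starJordan_defect e u v
  have h2 := h.starJordan_defect (1 - e) u v
  simp only [starJordan_def, star_sub, star_one, heStar, sub_mul, mul_sub, one_mul, mul_one,
    hu, hu', hv, hv', sub_self, add_zero, h.defect_zero_right, h.defect_zero_left] at h1 h2
  refine htf _ ?_
  rw [← add_zero (0 : A)]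
  nth_rw 1 [← h1]
  rw [← h2]; abel

theorem defect_diagonal_offDiagonal [Module ℂ A] [SMulCommClass ℂ A A] [IsScalarTower ℂ A A]
    (halt₁ : ∀ a b : A, a * a * b = a * (a * b)) (halt₂ : ∀ a b : A, b * a * a = b * (a * a))
    (heIdem : e * e = e) {u v : A} (hu : e * u = u * e) (hv : e * v + v * e = v) :
    addDefect H u v = 0 := by
  have h1 := h.starJordan_defect e u v
  have h2 : e ⋄ addDefect H u v = addDefect H u v := by
    rw [starJordan_def, heStar, h.offDiagonal_of_map_zero htf heStar hv]
  have hv2 : e * ((2⁻¹ : ℂ) • v) + ((2⁻¹ : ℂ) • v) * e = (2⁻¹ : ℂ) • v := by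
    rw [mul_smul_comm, smul_mul_assoc, ← smul_add, hv]
  have hv3 : (2⁻¹ : ℂ) • v + (2⁻¹ : ℂ) • v = v := by rw [← add_smul]; norm_num
  have h3 : e ⋄ u = e * u + e * u := by rw [starJordan_def, heStar, ← hu]
  have h4 : e ⋄ v = v := by rw [starJordan_def, heStar, hv]
  rw [h2, h3, h4, ← hv3, h.defect_add_self, hv3] at h1
  have h5 : e * (e * u) = e * u := by rw [← halt₁, heIdem]
  have h6 : e * u * e = e * u := by rw [hu, halt₂, heIdem]
  have h7 := h.starJordan_defect (1 - e) (e * u) ((2⁻¹ : ℂ) • v)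
  have h8 : (1 - e) ⋄ addDefect H (e * u) ((2⁻¹ : ℂ) • v) =
      addDefect H (e * u) ((2⁻¹ : ℂ) • v) := by
    have := h.offDiagonal_of_map_zero htf heStar (u := e * u) hv2
    rw [sub_starJordan, one_starJordan, starJordan_def, heStar, this, add_sub_cancel_right]
  have h9 : (1 - e) ⋄ (e * u) = 0 := by
    rw [sub_starJordan, one_starJordan, starJordan_def, heStar, h5, h6, sub_self]
  rw [h8, h9, h.defect_zero_left] at h7
  rw [h1, h7, add_zero]

/-- If `u e = 0` and `v` lies in `A₁₂ + A₂₁`, the defect of `u` and `v` has no `A₂₁` component. -/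
theorem defect_peirce_mul_eq_zero (halt₁ : ∀ a b : A, a * a * b = a * (a * b))
    (heIdem : e * e = e) {u v : A} (hu' : u * e = 0) (hv : e * v + v * e = v) :
    addDefect H u v * e = 0 := by
  have h1 := h.defect_starJordan u v e
  have h2 : u ⋄ e = 0 := by
    rw [starJordan_def, self_mul_star heStar, hu', star_zero, add_zero]
  rw [h2, h.defect_zero_left, starJordan_def] at h1
  have h3 := h.offDiagonal_of_map_zero htf heStar (u := u) hv
  have hee : ∀ w : A, e * (e * w) = e * w := fun w => by rw [← halt₁, heIdem]
  have h4 := congrArg (e * ·) h3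
  simp only [mul_add, hee, add_eq_left] at h4
  have h5 := congrArg (e * ·) h1
  simp only [mul_add, hee, mul_zero, h4, zero_add] at h5
  rwa [h5, add_zero] at h1

theorem defect_peirce_transpose (halt₁ : ∀ a b : A, a * a * b = a * (a * b))
    (heIdem : e * e = e) {u v : A} (hu' : u * e = 0)
    (hv : e * v = 0) (hv' : v * e = v) : addDefect H u v = 0 := by
  have h1 := h.defect_peirce_mul_eq_zero htf heStar halt₁ heIdem (u := u) (v := v) hu'
    (by rw [hv, hv', zero_add])
  have h2 := h.defect_starJordan u v (1 - e)
  have h3 : v ⋄ (1 - e) = 0 := by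
    have : (1 - e) * star v = star (v * (1 - e)) := by
      rw [star_mul, star_sub, star_one, heStar]
    rw [starJordan_def, this, mul_sub, hv', mul_one, sub_self, star_zero, add_zero]
  rw [h3, h.defect_zero_right, starJordan_def] at h2
  have h4 := h.offDiagonal_of_map_zero htf heStar (u := u) (v := v) (by rw [hv, hv', zero_add])
  rw [h1, add_zero] at h4
  have h5 := congrArg (e * ·) h2
  have h6 : ∀ w, e * ((1 - e) * w) = 0 := fun w => by
    rw [sub_mul, one_mul, mul_sub, ← halt₁, heIdem, sub_self]
  simp only [mul_add, h6, mul_sub, mul_one, h1, sub_zero, mul_zero, add_zero, h4] at h5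
  exact h5

theorem defect_peirce_location (halt₁ : ∀ a b : A, a * a * b = a * (a * b))
    (heIdem : e * e = e) {u v : A} (hu' : u * e = 0)
    (hv : e * v = v) (hv' : v * e = 0) :
    e * addDefect H u v = addDefect H u v ∧ addDefect H u v * e = 0 := by
  have hv2 : e * v + v * e = v := by rw [hv, hv', add_zero]
  have h1 := h.defect_peirce_mul_eq_zero htf heStar halt₁ heIdem (u := u) (v := v) hu' hv2
  have h2 := h.offDiagonal_of_map_zero htf heStar (u := u) hv2
  rw [h1, add_zero] at h2
  exact ⟨h2, h1⟩

theorem defect_diagonal (halt₁ : ∀ a b : A, a * a * b = a * (a * b))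
    (halt₂ : ∀ a b : A, b * a * a = b * (a * a)) (heIdem : e * e = e)
    (hcl : ∀ x : A, (∀ r : A, x * r * (1 - e) = 0) → x = 0) {u v : A}
    (hu : e * u = u) (hu' : u * e = u) (hv : e * v = v) (hv' : v * e = v)
    (hpeirce : ∀ a b : A, e * a = a → a * e = 0 → e * b = b → b * e = 0 →
      addDefect F a b = 0) : addDefect H u v = 0 := by
  set z := addDefect H u v with hz
  have h1 : z + z = e * z + z * e := by
    have h2 := h.starJordan_defect (1 - e) u v
    simp only [starJordan_def, star_sub, star_one, heStar, sub_mul, mul_sub, one_mul, mul_one,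
      hu, hu', hv, hv', sub_self, add_zero, h.defect_zero_right] at h2
    rw [← hz] at h2
    rw [← sub_eq_zero, ← h2]; abel
  have hee : ∀ w : A, e * (e * w) = e * w := fun w => by rw [← halt₁, heIdem]
  have hee' : ∀ w : A, w * e * e = w * e := fun w => by rw [halt₂, heIdem]
  have h3 := congrArg (e * ·) h1
  simp only [mul_add, hee, add_right_inj] at h3
  have h4 := congrArg (· * e) h1
  simp only [add_mul, hee', add_left_inj] at h4
  have h5 : e * z = z * e := by rw [h3, flexible_of_alternative halt₁ halt₂, ← h4]
  have h6 : e * z = z := by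
    refine (sub_eq_zero.1 (htf _ ?_)).symm
    rw [← h5, ← sub_eq_zero] at h1
    rw [← h1]; abel
  refine eq_zero_of_mul_peirce_eq_zero htf halt₁ halt₂ heIdem hcl h6 (h5 ▸ h6) fun a ha ha' => ?_
  have hstar : e * star a = 0 := by rw [self_mul_star heStar, ha', star_zero]
  have hstar' : star a * e = star a := by rw [star_mul_self_eq heStar, ha]
  have hann : ∀ w : A, e * w = w → w * e = w → a * star w = 0 := fun w hw hw' =>
    mul_eq_zero_of_peirce htf halt₂ heIdem ha'
      (by rw [self_mul_star heStar, hw'])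
      (by rw [star_mul_self_eq heStar, hw])
  have hmul : ∀ w : A, e * w = w → w * e = w →
      w ⋄ a = w * a ∧ e * (w * a) = w * a ∧ w * a * e = 0 := fun w hw hw' => by
    refine ⟨by rw [starJordan_def, hann w hw hw', add_zero], ?_, ?_⟩
    · rw [mul_mul_of_left_alternative halt₁, hw, hw', ha]; abel
    · rw [mul_mul_of_right_alternative halt₂, hw', ha, ha']; simp
  have h7 := h.defect_starJordan u v a
  rw [← hz, (hmul z h6 (h5 ▸ h6)).1, (hmul u hu hu').1, (hmul v hv hv').1] at h7
  rw [h7]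
  exact hpeirce _ _ (hmul u hu hu').2.1 (hmul u hu hu').2.2 (hmul v hv hv').2.1
    (hmul v hv hv').2.2

variable [Module ℂ A] [SMulCommClass ℂ A A] [IsScalarTower ℂ A A]

theorem left_defect_peirce (halt₁ : ∀ a b : A, a * a * b = a * (a * b))
    (halt₂ : ∀ a b : A, b * a * a = b * (a * a)) (heIdem : e * e = e) {a b : A}
    (ha : e * a = a) (ha' : a * e = 0) (hb : e * b = b) (hb' : b * e = 0) :
    addDefect F a b = 0 := by
  have hstar : e * star a = 0 := by rw [self_mul_star heStar, ha', star_zero]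
  have hstar' : star a * e = star a := by rw [star_mul_self_eq heStar, ha]
  have hab : e * (a * b) = 0 := by
    rw [mul_mul_of_left_alternative halt₁, ha, ha', hb]; simp
  have hab' : a * b * e = a * b := by
    rw [mul_mul_of_right_alternative halt₂, ha', hb, hb']; simp
  have hba : e * (b * star a) = b * star a := by
    rw [mul_mul_of_left_alternative halt₁, hb, hb', hstar]; simp
  have hba' : b * star a * e = b * star a := by
    rw [mul_mul_of_right_alternative halt₂, hb', hstar, hstar']; simp
  -- additivity of `F` and `H` across Peirce components
  have hF1 : ∀ u v : A, e * u = u * e → e * v + v * e = v → F (u + v) = F u + F v := by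
    intro u v hu hv
    refine map_add_of_addDefect ?_
    rw [h.left_defect, h.defect_diagonal_offDiagonal htf heStar halt₁ halt₂ heIdem, add_zero]
    · rw [mul_smul_comm, smul_mul_assoc, hu]
    · rw [mul_smul_comm, smul_mul_assoc, ← smul_add, hv]
  have hF2 : ∀ u v : A, u * e = 0 → e * v = 0 → v * e = v →
      F (u + v) = F u + F v := by
    intro u v hu' hv hv'
    refine map_add_of_addDefect ?_
    rw [h.left_defect, h.defect_peirce_transpose htf heStar halt₁ heIdem, add_zero]
    · rw [smul_mul_assoc, hu', smul_zero]
    · rw [mul_smul_comm, hv, smul_zero]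
    · rw [smul_mul_assoc, hv']
  have hH : ∀ u v : A, e * u = u * e → e * v + v * e = v → addDefect H u v = 0 := fun u v =>
    h.defect_diagonal_offDiagonal htf heStar halt₁ halt₂ heIdem
  have hG : G (e + a) = G e + G a := map_add_of_addDefect (by
    rw [h.defect, hH _ _ rfl (by rw [ha, ha', add_zero])])
  have hH' : H (1 - e + b) = H (1 - e) + H b := map_add_of_addDefect (hH _ _
    (by simp [mul_sub, sub_mul]) (by rw [hb, hb', add_zero]))
  -- expand the product of `e + a` and `(1 - e) + b`
  have hprod := h.map (e + a) (1 - e + b)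
  have hexp : (e + a) ⋄ (1 - e + b) = b * star a + ((a + b) + (star a + a * b)) := by
    simp only [starJordan_def, star_add, heStar, add_mul, mul_add, sub_mul, mul_sub, one_mul,
      mul_one, heIdem, ha', hb, hb', hstar]
    abel
  rw [hG, hH'] at hprod
  have hprod2 : F ((e + a) ⋄ (1 - e + b)) =
      F (e ⋄ (1 - e)) + F (e ⋄ b) + F (a ⋄ (1 - e)) + F (a ⋄ b) := by
    rw [hprod]
    simp only [h.map, add_starJordan, starJordan_add]; abel
  have t1 : e ⋄ (1 - e) = 0 := by
    simp [starJordan_def, heStar, mul_sub, sub_mul, heIdem]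
  have t2 : e ⋄ b = b := by rw [starJordan_def, heStar, hb, hb', add_zero]
  have t3 : a ⋄ (1 - e) = a + star a := by
    simp [starJordan_def, mul_sub, sub_mul, ha', hstar]
  have t4 : a ⋄ b = b * star a + a * b := by rw [starJordan_def, add_comm]
  rw [hexp, t1, t2, t3, t4, h.left_zero, hF1 (b * star a) (a * b) (by rw [hba, hba'])
      (by rw [hab, hab', zero_add]), hF2 a (star a) ha' hstar hstar',
    hF1 (b * star a) _ (by rw [hba, hba']) (by
      simp only [mul_add, add_mul, ha, ha', hb, hb', hstar, hstar', hab, hab']; abel),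
    hF2 (a + b) (star a + a * b) (by rw [add_mul, ha', hb', add_zero])
      (by rw [mul_add, hstar, hab, add_zero]) (by rw [add_mul, hstar', hab'])] at hprod2
  have hsum : addDefect F a b + addDefect F (star a) (a * b) = 0 := by
    rw [← sub_eq_zero] at hprod2
    rw [← hprod2, addDefect, addDefect]; abel
  have hloc : e * addDefect F a b = addDefect F a b := by
    rw [h.left_defect, mul_add, (h.defect_peirce_location htf heStar halt₁ heIdem _ _ _).1]
    · rw [smul_mul_assoc, ha', smul_zero]
    · rw [mul_smul_comm, hb]
    · rw [smul_mul_assoc, hb', smul_zero]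
  have hloc' : e * addDefect F (star a) (a * b) = 0 := by
    have hf : (1 - e) * (1 - e) = 1 - e := by
      simp only [sub_mul, mul_sub, one_mul, mul_one, heIdem]; abel
    have := (h.defect_peirce_location (e := 1 - e) htf (by rw [star_sub, star_one, heStar])
      halt₁ hf (u := (2⁻¹ : ℂ) • star a) (v := (2⁻¹ : ℂ) • (a * b))
      (by rw [smul_mul_assoc, mul_sub, hstar', mul_one, sub_self, smul_zero])
      (by rw [mul_smul_comm, sub_mul, hab, one_mul, sub_zero])
      (by rw [smul_mul_assoc, mul_sub, hab', mul_one, sub_self, smul_zero])).1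
    rw [sub_mul, one_mul, sub_eq_self] at this
    rw [h.left_defect, mul_add, this, add_zero]
  have := congrArg (e * ·) hsum
  simpa only [mul_add, hloc, hloc', add_zero, mul_zero] using this

theorem right_additive_on_peirce (halt₁ : ∀ a b : A, a * a * b = a * (a * b))
    (halt₂ : ∀ a b : A, b * a * a = b * (a * a)) (heIdem : e * e = e) {a b : A}
    (ha : e * a = a) (ha' : a * e = 0) (hb : e * b = b) (hb' : b * e = 0) :
    H (a + b) = H a + H b :=
  map_add_of_addDefect (h.right_defect_eq_zero htf
    (h.left_defect_peirce htf heStar halt₁ halt₂ heIdem (by rw [mul_add, ha])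
      (by rw [add_mul, ha', add_zero]) (by rw [mul_add, hb]) (by rw [add_mul, hb', add_zero])))

theorem right_additive_on_diagonal (halt₁ : ∀ a b : A, a * a * b = a * (a * b))
    (halt₂ : ∀ a b : A, b * a * a = b * (a * a)) (heIdem : e * e = e)
    (hcl : ∀ x : A, (∀ r : A, x * r * (1 - e) = 0) → x = 0) {a b : A}
    (ha : e * a = a) (ha' : a * e = a) (hb : e * b = b) (hb' : b * e = b) :
    H (a + b) = H a + H b :=
  map_add_of_addDefect (h.defect_diagonal htf heStar halt₁ halt₂ heIdem hcl ha ha' hb hb'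
    fun _ _ hc hc' hd hd' => h.left_defect_peirce htf heStar halt₁ halt₂ heIdem hc hc' hd hd')

theorem right_additive (halt₁ : ∀ a b : A, a * a * b = a * (a * b))
    (halt₂ : ∀ a b : A, b * a * a = b * (a * a)) (heIdem : e * e = e)
    (hsp : ∀ x : A, (∀ r : A, x * r * e = 0) → x = 0)
    (hcl : ∀ x : A, (∀ r : A, x * r * (1 - e) = 0) → x = 0) (u v : A) :
    H (u + v) = H u + H v := by
  have hf : (1 - e) * (1 - e) = 1 - e := by
    simp only [sub_mul, mul_sub, one_mul, mul_one, heIdem]; abel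
  have hfStar : star (1 - e) = 1 - e := by rw [star_sub, star_one, heStar]
  have hee : ∀ w : A, e * (e * w) = e * w := fun w => by rw [← halt₁, heIdem]
  have hee' : ∀ w : A, w * e * e = w * e := fun w => by rw [halt₂, heIdem]
  have hfl : ∀ w : A, e * w * e = e * (w * e) := fun w =>
    (flexible_of_alternative halt₁ halt₂ e w).symm
  have hsplit : ∀ p q r s : A, e * p = p → p * e = p → e * q = q → q * e = 0 → e * r = 0 →
      r * e = r → e * s = 0 → s * e = 0 →
      H ((p + s) + (q + r)) = (H p + H s) + (H q + H r) := by
    intro p q r s hp hp' hq hq' hr hr' hs hs'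
    rw [map_add_of_addDefect (h.defect_diagonal_offDiagonal htf heStar halt₁ halt₂ heIdem _ _),
      map_add_of_addDefect (h.defect_diagonal_diagonal htf heStar hp hp' hs hs'),
      map_add_of_addDefect (h.defect_peirce_transpose htf heStar halt₁ heIdem hq' hr hr')]
    · rw [mul_add, add_mul, hp, hp', hs, hs']
    · rw [mul_add, add_mul, hq, hq', hr, hr']; abel
  have hex : ∀ w : A, ∃ p q r s : A, w = (p + s) + (q + r) ∧ e * p = p ∧ p * e = p ∧
      e * q = q ∧ q * e = 0 ∧ e * r = 0 ∧ r * e = r ∧ e * s = 0 ∧ s * e = 0 := by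
    intro w
    have hk : e * (w * e) * e = e * (w * e) := by rw [hfl, hee']
    refine ⟨e * (w * e), e * w - e * (w * e), w * e - e * (w * e),
      w - e * w - w * e + e * (w * e), by abel, hee _, hk, ?_, ?_, ?_, ?_, ?_, ?_⟩ <;>
    simp only [mul_sub, mul_add, sub_mul, add_mul, hee, hee', hk, hfl] <;> abel
  obtain ⟨p, q, r, s, rfl, hp, hp', hq, hq', hr, hr', hs, hs'⟩ := hex u
  obtain ⟨p₁, q₁, r₁, s₁, rfl, kp, kp', kq, kq', kr, kr', ks, ks'⟩ := hex v
  have h1 : (p + s + (q + r)) + (p₁ + s₁ + (q₁ + r₁)) =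
      ((p + p₁) + (s + s₁)) + ((q + q₁) + (r + r₁)) := by abel
  have hfl1 : ∀ {w : A}, e * w = 0 → (1 - e) * w = w := fun hw => by
    rw [sub_mul, hw, one_mul, sub_zero]
  have hfr1 : ∀ {w : A}, w * e = 0 → w * (1 - e) = w := fun hw => by
    rw [mul_sub, hw, mul_one, sub_zero]
  have hfr0 : ∀ {w : A}, w * e = w → w * (1 - e) = 0 := fun hw => by
    rw [mul_sub, hw, mul_one, sub_self]
  rw [h1, hsplit p q r s hp hp' hq hq' hr hr' hs hs',
    hsplit p₁ q₁ r₁ s₁ kp kp' kq kq' kr kr' ks ks',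
    hsplit (p + p₁) (q + q₁) (r + r₁) (s + s₁) (by rw [mul_add, hp, kp])
      (by rw [add_mul, hp', kp']) (by rw [mul_add, hq, kq]) (by rw [add_mul, hq', kq', add_zero])
      (by rw [mul_add, hr, kr, add_zero]) (by rw [add_mul, hr', kr'])
      (by rw [mul_add, hs, ks, add_zero]) (by rw [add_mul, hs', ks', add_zero]),
    h.right_additive_on_diagonal htf heStar halt₁ halt₂ heIdem hcl hp hp' kp kp',
    h.right_additive_on_diagonal htf hfStar halt₁ halt₂ hf (by simpa using hsp)
      (hfl1 hs) (hfr1 hs') (hfl1 ks) (hfr1 ks'),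
    h.right_additive_on_peirce htf heStar halt₁ halt₂ heIdem hq hq' kq kq',
    h.right_additive_on_peirce htf hfStar halt₁ halt₂ hf (hfl1 hr) (hfr0 hr') (hfl1 kr)
      (hfr0 kr')]
  abel

end Idempotent

end IsStarJordanTriple

section Unit

variable {A : Type*} [NonAssocRing A] [StarRing A] {e d : A}

/-- A commuting element `d` with `y (d x) = x (d y)` for self-adjoint `x`, `y` satisfies
`e d = 0`. -/
theorem idem_mul_eq_zero_of_commute (htf : ∀ x : A, x + x = 0 → x = 0)
    (halt₁ : ∀ a b : A, a * a * b = a * (a * b)) (halt₂ : ∀ a b : A, b * a * a = b * (a * a))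
    (heStar : star e = e) (heIdem : e * e = e)
    (hcl : ∀ x : A, (∀ r : A, x * r * (1 - e) = 0) → x = 0)
    (hd : ∀ x : A, d * x = x * d)
    (hsymm : ∀ x y : A, star x = x → star y = y → y * (d * x) = x * (d * y)) : e * d = 0 := by
  have hee : ∀ w : A, e * (e * w) = e * w := fun w => by rw [← halt₁, heIdem]
  obtain ⟨p, q, rfl, hp, hp', hq, hq'⟩ : ∃ p q : A, d = p + q ∧ e * p = p ∧ p * e = p ∧
      e * q = 0 ∧ q * e = 0 := by
    have h2 : e * d * e = e * d := by rw [← flexible_of_alternative halt₁ halt₂, hd, hee]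
    exact ⟨e * d, d - e * d, by abel, hee d, h2, by rw [mul_sub, hee, sub_self],
      by rw [sub_mul, h2, hd, sub_self]⟩
  rw [mul_add, hp, hq, add_zero]
  refine eq_zero_of_mul_peirce_eq_zero htf halt₁ halt₂ heIdem hcl hp hp' fun a ha ha' => ?_
  have hstar : e * star a = 0 := by rw [self_mul_star heStar, ha', star_zero]
  have h1 : a * p = 0 := mul_eq_zero_of_peirce htf halt₂ heIdem ha' hp hp'
  have h2 : e * (star a * p) = 0 := by
    rw [mul_mul_of_left_alternative halt₁, hstar, star_mul_self_eq heStar, ha, hp]; simp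
  have h3 : e * (p * a) = p * a := by
    rw [mul_mul_of_left_alternative halt₁, hp, hp', ha]; simp
  have h4 : e * (q * a) = 0 := by
    have h5 : e * (q * a) = -(q * a) := by
      rw [mul_mul_of_left_alternative halt₁, hq, hq', ha]; simp
    have h6 := hee (q * a)
    rw [h5, mul_neg, h5, neg_neg] at h6
    rw [h5, htf (q * a) (by nth_rw 1 [h6]; simp), neg_zero]
  have h5 : e * (q * star a) = 0 := by
    rw [mul_mul_of_left_alternative halt₁, hq, hq', hstar]; simp
  have h6 : e * (p * star a) = 0 := by
    have h7 : e * (p * star a) = p * star a + p * star a := by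
      rw [mul_mul_of_left_alternative halt₁, hp, hp', hstar]; simp
    have h8 := hee (p * star a)
    rw [h7, mul_add, h7] at h8
    rw [h7]
    simpa using h8
  have h7 := congrArg (e * ·) (hsymm e (a + star a) heStar (by rw [star_add, star_star, add_comm]))
  simp only [add_mul, mul_add, hp', hq', h1, h2, h3, h4, h5, h6, mul_zero, add_zero] at h7
  exact h7.symm

end Unit

theorem stmt_14 {A : Type*} [NonAssocRing A] [Module ℂ A]
    [SMulCommClass ℂ A A] [IsScalarTower ℂ A A] [StarRing A]
    (halt₁ : ∀ a b : A, a * a * b = a * (a * b))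
    (halt₂ : ∀ a b : A, b * a * a = b * (a * a))
    (e : A) (heStar : star e = e) (heIdem : e * e = e) (he0 : e ≠ 0) (he1 : e ≠ 1)
    (hsp : ∀ x : A, (∀ r : A, x * r * e = 0) → x = 0)
    (hcl : ∀ x : A, (∀ r : A, x * r * (1 - e) = 0) → x = 0)
    (n : ℕ) (hn : 2 ≤ n) (Φ : A → A)
    (hΦ : ∀ x y : A,
      Φ (leftStarJordan (List.ofFn (lastTwoFamily n x y))) =
        ∑ k : Fin n, leftStarJordan (List.ofFn
          (Function.update (lastTwoFamily n x y) k (Φ (lastTwoFamily n x y k))))) :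
    ∀ a : A, Φ (star a) = star (Φ a) := by
  have hmc : ∀ (m : ℕ) (x : A), m ≠ 0 → m • x = 0 → x = 0 := fun m x hm hx => by
    have hm' : (m : ℂ) ≠ 0 := Nat.cast_ne_zero.2 hm
    rw [← one_smul ℂ x, ← inv_mul_cancel₀ hm', mul_smul, Nat.cast_smul_eq_nsmul, hx, smul_zero]
  have htf : ∀ x : A, x + x = 0 → x = 0 := fun x hx =>
    hmc 2 x two_ne_zero (by rw [two_nsmul, hx])
  obtain ⟨M, p, q, hM, hid⟩ := exists_lastTwo_identity hn hΦ
  set d := Φ 1 with hd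
  set t := p • d + q • star d with ht
  have htriple : IsStarJordanTriple (fun z => Φ (M • z)) (fun z => M • Φ z + t ⋄ z)
      (fun z => M • Φ z) := by
    refine ⟨fun x y => ?_, fun u v => ?_⟩
    · simp only [hid, add_starJordan, nsmul_starJordan, starJordan_nsmul, nsmul_add]
      abel
    · simp only [addDefect, starJordan_add]; abel
  have hadd : ∀ u v, Φ (u + v) = Φ u + Φ v := fun u v => by
    have h := htriple.right_additive htf heStar halt₁ halt₂ heIdem hsp hcl u v
    refine sub_eq_zero.1 (hmc M _ hM ?_)
    rw [nsmul_sub, h, nsmul_add, sub_self]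
  have hsmul : ∀ (m : ℕ) (z : A), Φ (m • z) = m • Φ z := fun m z =>
    map_nsmul (AddMonoidHom.mk' Φ hadd) m z
  have hβ : ∀ y, (M • d + (t + star t)) ⋄ y = 0 := fun y => by
    have h := hid 1 y
    have h1 : t ⋄ 1 = t + star t := by rw [starJordan_def, mul_one, one_mul]
    rw [hsmul, one_starJordan, one_starJordan, hadd, smul_add M (Φ 1 ⋄ y), h1, ← sub_eq_zero] at h
    rw [add_starJordan, nsmul_starJordan, ← neg_eq_zero, ← h]
    abel
  have hskew : d + star d = 0 := by
    refine hmc (M + (2 * p + 2 * q)) _ (by omega) ?_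
    have h := hβ 1
    rw [starJordan_def, mul_one, one_mul, ht] at h
    simp only [star_add, star_nsmul, star_star] at h
    rw [← h]
    simp only [add_nsmul, nsmul_add, mul_nsmul', two_nsmul]
    abel
  have hstar : star d = -d := (neg_eq_of_add_eq_zero_right hskew).symm
  have hdy : ∀ y, d ⋄ y = 0 := fun y => by
    refine hmc M _ hM ?_
    have h := hβ y
    have h1 : t + star t = 0 := by
      simp only [ht, star_add, star_nsmul, hstar, smul_neg, star_neg]; abel
    rwa [h1, add_zero, nsmul_starJordan] at h
  have hcomm : ∀ y, d * y = y * d := fun y => by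
    have h := hdy y
    rwa [starJordan_def, hstar, mul_neg, ← sub_eq_add_neg, sub_eq_zero] at h
  have ht0 : ∀ y, t ⋄ y = 0 := fun y => by
    have h : star d ⋄ y = 0 := by rw [starJordan_def, star_star, hstar, neg_mul, hcomm]; abel
    rw [ht, add_starJordan, nsmul_starJordan, nsmul_starJordan, hdy, h, smul_zero, smul_zero,
      add_zero]
  have hder : ∀ x y, Φ (x ⋄ y) = Φ x ⋄ y + x ⋄ Φ y := fun x y => by
    have h := hid x y
    rw [hsmul, ht0, zero_starJordan, add_zero] at h
    exact sub_eq_zero.1 (hmc M _ hM (by rw [nsmul_sub, h, sub_self]))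
  have hΦstar : ∀ x, star (Φ x) = Φ (star x) - x * d - d * star x := fun x => by
    have h := hder x 1
    rw [starJordan_def, starJordan_def, starJordan_def, mul_one, mul_one, one_mul, one_mul,
      hadd, ← sub_eq_zero] at h
    rw [← sub_eq_zero, ← neg_eq_zero, ← h]; abel
  have hsymm : ∀ x y : A, star x = x → star y = y → y * (d * x) = x * (d * y) := by
    intro x y hx hy
    have h1 := hder x y
    have h2 : x ⋄ y = y ⋄ x := by rw [starJordan_def, starJordan_def, hx, hy, add_comm]
    rw [h2, hder] at h1
    simp only [starJordan_def, hΦstar, hx, hy, mul_sub, ← hcomm x, ← hcomm y] at h1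
    refine sub_eq_zero.1 (htf _ ?_)
    rw [← sub_eq_zero] at h1
    rw [← h1]; abel
  have hd0 : d = 0 := by
    have h1 := idem_mul_eq_zero_of_commute htf halt₁ halt₂ heStar heIdem hcl hcomm hsymm
    have h2 := idem_mul_eq_zero_of_commute (e := 1 - e) htf halt₁ halt₂
      (by rw [star_sub, star_one, heStar])
      (by simp only [sub_mul, mul_sub, one_mul, mul_one, heIdem]; abel)
      (by simpa using hsp) hcomm hsymm
    rwa [sub_mul, one_mul, h1, sub_zero] at h2
  intro a
  rw [hΦstar, hd0, mul_zero, zero_mul, sub_zero, sub_zero]
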